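/- Let r ≥ 2 and d₁ ≥ d₂ ≥ ⋯ ≥ d_r ≥ 1 be integers with d₁ < s and 2p − 3s > 0, where s = d₂+⋯+d_r and p = Σ_{2≤i<j≤r} d_i d_j; set d = d₁+⋯+d_r and D = Σ_{1≤i<j≤r} d_i d_j. Then C(d+2,2) ≤ 2D, and equality C(d+2,2) = 2D holds if and only if r = 4 and (d₁,d₂,d₃,d₄) = (2,2,2,1). (Arithmetic claim established inside the proof of Proposition 7.1: below the hyperplane d₁ = s, when 2p > 3s the expected dimension C(d+2,2) − 2D is negative except exactly for the partition [2,2,2,1], where it is zero.) -/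

import Mathlib

open Finset

/-- `D = Σ_{1 ≤ i < j ≤ r} d_i d_j`. -/
def Dval {r : ℕ} (d : Fin r → ℕ) : ℕ :=
  ∑ q ∈ univ.filter (fun q : Fin r × Fin r => q.1 < q.2), d q.1 * d q.2

/-- `s = d_2 + ⋯ + d_r`. -/
def sval {r : ℕ} (d : Fin r → ℕ) : ℕ :=
  ∑ i ∈ univ.filter (fun i : Fin r => i.val ≠ 0), d i

/-- `p = Σ_{2 ≤ i < j ≤ r} d_i d_j = D - d_1 s`. -/
def pval {r : ℕ} (d : Fin r → ℕ) : ℕ :=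
  ∑ q ∈ univ.filter (fun q : Fin r × Fin r => q.1 < q.2 ∧ q.1.val ≠ 0), d q.1 * d q.2

theorem Dval_succ {n : ℕ} (d : Fin (n + 1) → ℕ) :
    Dval d = d 0 * ∑ i : Fin n, d i.succ + Dval (fun i : Fin n => d i.succ) := by
  simp [Dval, sum_filter, Fintype.sum_prod_type, Fin.sum_univ_succ, mul_sum]

theorem sval_succ {n : ℕ} (d : Fin (n + 1) → ℕ) : sval d = ∑ i : Fin n, d i.succ := by
  simp [sval, sum_filter, Fin.sum_univ_succ]

theorem pval_succ {n : ℕ} (d : Fin (n + 1) → ℕ) :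
    pval d = Dval (fun i : Fin n => d i.succ) := by
  simp [pval, Dval, sum_filter, Fintype.sum_prod_type, Fin.sum_univ_succ]

theorem two_mul_Dval_add_sum_sq {n : ℕ} (d : Fin n → ℕ) :
    2 * Dval d + ∑ i, d i ^ 2 = (∑ i, d i) ^ 2 := by
  induction n with
  | zero => simp [Dval]
  | succ n ih =>
    have h := ih (fun i => d i.succ)
    rw [Dval_succ, Fin.sum_univ_succ, Fin.sum_univ_succ]
    linear_combination h

/-- The expected dimension bound in terms of the two largest parts `a ≥ m`, and of the sum `t`,
the second elementary symmetric function `p` and the sum of squares `q` of the other parts. -/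
theorem expected_dim_bound {a m t p q : ℤ} (hma : m ≤ a) (ht : 0 ≤ t) (hm : 1 ≤ m) (hp : 0 ≤ p)
    (hq : 2 * p + q = t ^ 2) (hqm : q ≤ m * t) (htq : t ≤ q)
    (has : a < m + t) (hps : 3 * (m + t) < 2 * (m * t + p)) :
    (a + (m + t) + 2) * (a + (m + t) + 1) ≤ 4 * (a * (m + t) + (m * t + p)) ∧
    ((a + (m + t) + 2) * (a + (m + t) + 1) = 4 * (a * (m + t) + (m * t + p)) →
      a = 2 ∧ m = 2 ∧ t = 3 ∧ q = 5) := by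
  obtain ⟨b, rfl⟩ : ∃ b, a = m + b := ⟨a - m, by ring⟩
  have hb : 0 ≤ b := by linarith
  have hbt : b + 1 ≤ t := by linarith
  have key : 4 * ((m + b) * (m + t) + (m * t + p)) - (m + b + (m + t) + 2) * (m + b + (m + t) + 1)
      = (4 * (m * t) + t ^ 2 - 2 * q - 3 * t - 6 * m - 2) + b * (2 * t - b - 3) := by
    linear_combination 2 * hq
  have hb1 : 0 ≤ b * (2 * t - b - 3) := by
    rcases hb.eq_or_lt with rfl | h
    · simp
    · exact mul_nonneg hb (by linarith)
  have hb2 : b * (2 * t - b - 3) = 0 → t = 3 → b = 0 := by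
    rintro h rfl
    rcases mul_eq_zero.mp h with h | h <;> omega
  rcases le_or_gt 4 t with h4 | h4
  · have : 0 < 4 * (m * t) + t ^ 2 - 2 * q - 3 * t - 6 * m - 2 := by
      nlinarith [mul_nonneg (by linarith : 0 ≤ t + 2 * m) (by linarith : 0 ≤ t - 4)]
    exact ⟨by linarith, fun h => by linarith⟩
  · generalize b * (2 * t - b - 3) = B at *
    generalize (m + b + (m + t) + 2) * (m + b + (m + t) + 1) = L at *
    generalize hP : (m + b) * (m + t) = P at *
    clear hP
    interval_cases t <;> refine ⟨by omega, fun h => ?_⟩ <;>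
      rcases le_or_gt m 3 with h3 | h3 <;> try interval_cases m
    all_goals omega

theorem eq_two_of_sum_eq_three_of_sum_sq_eq_five {n : ℕ} (e : Fin n → ℕ) (hpos : ∀ i, 1 ≤ e i)
    (h1 : ∑ i, e i = 3) (h2 : ∑ i, e i ^ 2 = 5) : n = 2 := by
  have hn : n ≤ 3 := by
    have := sum_le_sum (fun i (_ : i ∈ univ) => hpos i)
    simpa [h1] using this
  interval_cases n
  · simp at h1
  · simp at h1 h2
    simp [h1] at h2
  · rfl
  · have := hpos 0
    have := hpos 1
    have := hpos 2
    simp only [Fin.sum_univ_three] at h1 h2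
    have e0 : e 0 = 1 := by omega
    have e1 : e 1 = 1 := by omega
    have e2 : e 2 = 1 := by omega
    simp [e0, e1, e2] at h2

/-- Arithmetic claim in the proof of Proposition 7.1: if `d₁ < s` and `2p - 3s > 0`
then `C(d+2,2) ≤ 2D`, with equality exactly for `λ = [2,2,2,1]`. -/
theorem expected_dim_nonpositive_above_2p3s
    (r : ℕ) [NeZero r] (hr : 2 ≤ r)
    (d : Fin r → ℕ)
    (hanti : ∀ i j : Fin r, i ≤ j → d j ≤ d i)
    (hpos : ∀ i, 1 ≤ d i)
    (hds : d 0 < sval d)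
    (hps : 3 * sval d < 2 * pval d) :
    ((∑ i, d i) + 2).choose 2 ≤ 2 * Dval d ∧
    (((∑ i, d i) + 2).choose 2 = 2 * Dval d ↔
      (r = 4 ∧ d 0 = 2 ∧ d 1 = 2 ∧ d 2 = 2 ∧ d 3 = 1)) := by
  obtain ⟨n, rfl⟩ : ∃ n, r = n + 2 := ⟨r - 2, by omega⟩
  have hchoose : ∀ N : ℕ, 2 * (N + 2).choose 2 = (N + 2) * (N + 1) := fun N => by
    rw [Nat.choose_two_right, Nat.mul_div_cancel' (Nat.even_mul_pred_self _).two_dvd]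
    rfl
  have hC := hchoose (∑ i, d i)
  have hsq := two_mul_Dval_add_sum_sq (fun i : Fin n => d i.succ.succ)
  have hqm : ∑ i : Fin n, d i.succ.succ ^ 2 ≤ d 1 * ∑ i : Fin n, d i.succ.succ := by
    rw [mul_sum]
    refine sum_le_sum fun i _ => ?_
    rw [sq]
    refine Nat.mul_le_mul_right _ (hanti _ _ ?_)
    simp [Fin.le_def]
  have htq : ∑ i : Fin n, d i.succ.succ ≤ ∑ i : Fin n, d i.succ.succ ^ 2 :=
    sum_le_sum fun i _ => Nat.le_self_pow two_ne_zero _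
  have hma : d 1 ≤ d 0 := hanti _ _ (Fin.zero_le _)
  have hm := hpos 1
  have hparts := eq_two_of_sum_eq_three_of_sum_sq_eq_five (fun i : Fin n => d i.succ.succ)
    fun i => hpos _
  rw [sval_succ, Fin.sum_univ_succ, Fin.succ_zero_eq_one] at hds hps
  rw [pval_succ, Dval_succ] at hps
  rw [Fin.sum_univ_succ, Fin.sum_univ_succ, Fin.succ_zero_eq_one] at hC ⊢
  rw [Dval_succ, Dval_succ, Fin.sum_univ_succ, Fin.succ_zero_eq_one]
  simp only [Fin.succ_zero_eq_one] at hps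
  have hbound := expected_dim_bound (a := d 0) (m := d 1) (t := (∑ i : Fin n, d i.succ.succ : ℕ))
    (p := Dval (fun i : Fin n => d i.succ.succ)) (q := (∑ i : Fin n, d i.succ.succ ^ 2 : ℕ))
    (by exact_mod_cast hma) (by positivity) (by exact_mod_cast hm) (by positivity) (by exact_mod_cast hsq)
    (by exact_mod_cast hqm) (by exact_mod_cast htq) (by exact_mod_cast hds)
    (by exact_mod_cast hps)
  norm_cast at hbound
  obtain ⟨hle, heq⟩ := hbound
  refine ⟨by omega, fun h => ?_, ?_⟩
  · obtain ⟨h0, h1, ht, hq⟩ := heq (by omega)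
    obtain rfl := hparts ht hq
    have h23 : d 3 ≤ d 2 := hanti _ _ (show (2 : ℕ) ≤ 3 by norm_num)
    have ht' : d 2 + d 3 = 3 := by simpa [Fin.sum_univ_two] using ht
    have hq' : d 2 ^ 2 + d 3 ^ 2 = 5 := by simpa [Fin.sum_univ_two] using hq
    have h3 := hpos 3
    refine ⟨rfl, h0, h1, ?_, ?_⟩ <;> omega
  · rintro ⟨hr4, h0, h1, h2, h3⟩
    obtain rfl : n = 2 := by omega
    simp [Dval_succ, Fin.sum_univ_two, h0, h1, h2, h3]
    simp [Dval, Nat.choose]
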